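/- arXiv:0904.1023 — 2 statements merged into one kernel-verified Lean document; each statement's English description precedes it below -/
import Mathlib

section
/- For A = ℤ[t]/(t⁴), the first homology of the partial complex, H₁ = ker ∂₁ / im ∂₂, is isomorphic as an abelian group to (ℤ/2ℤ)⁴; that is, HS₁(ℤ[t]/(t⁴)) ≅ (ℤ/2ℤ)⁴. -/
open TensorProduct

set_option synthInstance.maxHeartbeats 1000000
set_option maxHeartbeats 1000000

/-- The algebra `A = ℤ[t]/(t^4)`. -/
noncomputable abbrev A : Type :=
  Polynomial ℤ ⧸ Ideal.span ({Polynomial.X ^ 4} : Set (Polynomial ℤ))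

/-- Generators `x k n` of `HS₁(ℤ[t]/(t⁴))`, with `x k n` standing for `t^k ⊗ t^n dt`. -/
def hsGen : ℕ → ℕ → Fin 4 → ZMod 2
  | 0, 1 => Pi.single 0 1
  | 0, 3 => Pi.single 1 1
  | 2, 1 => Pi.single 1 1
  | 1, 1 => Pi.single 2 1
  | 1, 3 => Pi.single 3 1
  | 3, 1 => Pi.single 3 1
  | _, _ => 0

/-- The class of `t^k ⊗ t^i ⊗ t^j` in `HS₁(ℤ[t]/(t⁴)) ≅ (ℤ/2ℤ)⁴`. -/
def hsClass (k i j : ℕ) : Fin 4 → ZMod 2 :=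
  j • hsGen k (i + j - 1) - k • hsGen 0 (i + j + k - 1)

lemma hsGen_eq_zero_left {k : ℕ} (n : ℕ) (hk : 4 ≤ k) : hsGen k n = 0 := by
  obtain ⟨k, rfl⟩ := Nat.exists_eq_add_of_le' hk
  rfl

lemma hsGen_eq_zero_right (k : ℕ) {n : ℕ} (hn : 4 ≤ n) : hsGen k n = 0 := by
  obtain ⟨n, rfl⟩ := Nat.exists_eq_add_of_le' hn
  rcases k with _ | _ | _ | _ | k <;> rfl

lemma nsmul_hsGen_pred (k : ℕ) {n : ℕ} (hn : 4 ≤ n) : n • hsGen k (n - 1) = 0 := by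
  rcases hn.eq_or_lt with rfl | hn
  · funext m
    simp [show (4 : ZMod 2) = 0 from rfl]
  · rw [hsGen_eq_zero_right k (by omega), smul_zero]

lemma hsClass_eq_zero {k i j : ℕ} (h : 4 ≤ k ∨ 4 ≤ i ∨ 4 ≤ j) : hsClass k i j = 0 := by
  have h₁ : j • hsGen k (i + j - 1) = 0 := by
    rcases Nat.eq_zero_or_pos j with rfl | hj
    · simp
    rcases h with h | h
    · rw [hsGen_eq_zero_left _ h, smul_zero]
    rcases Nat.eq_zero_or_pos i with rfl | hi
    · rw [zero_add, nsmul_hsGen_pred k (by omega)]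
    · rw [hsGen_eq_zero_right k (by omega), smul_zero]
  have h₂ : k • hsGen 0 (i + j + k - 1) = 0 := by
    rcases Nat.eq_zero_or_pos k with rfl | hk
    · simp
    rcases Nat.eq_zero_or_pos (i + j) with hij | hij
    · rw [hij, zero_add, nsmul_hsGen_pred 0 (by omega)]
    · rw [hsGen_eq_zero_right 0 (by omega), smul_zero]
  rw [hsClass, h₁, h₂, sub_zero]

lemma hsClass_relation (a b c d : Fin 4) :
    hsClass (a + b) c d + hsClass d (c + a) b + hsClass (b + c + a) 0 d +
      hsClass d (b + c) a = 0 := by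
  revert a b c d
  decide

lemma hsClass_unit (a : Fin 4) : hsClass 0 a 0 = 0 := by
  simp [hsClass]

section Presentation

variable {G : Type*} [AddCommGroup G] {F : ℕ → ℕ → ℕ → G}

lemma relation_swap
    (hR : ∀ a b c d, F (a + b) c d + F d (c + a) b + F (b + c + a) 0 d + F d (b + c) a = 0)
    (hU : ∀ a, F 0 a 0 = 0) :
    (∀ b c, F b c 0 = - F c 0 b) ∧ (∀ b c, F 0 c b = F c 0 b) ∧
      ∀ b c d, F b c d = - F d c b := by
  have h1 (c : ℕ) : F c 0 0 = 0 := by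
    have := hR 0 0 c 0
    simpa [hU] using this
  have h2 (b : ℕ) : F 0 0 b = 0 := by
    have := hR 0 b 0 0
    simpa [hU, h1] using this
  have h3 (b c : ℕ) : F b c 0 + F 0 c b = 0 := by
    have := hR 0 b c 0
    simpa [hU, h1] using this
  have h4 (c d : ℕ) : F 0 c d + F d c 0 + F c 0 d + F d c 0 = 0 := by
    have := hR 0 0 c d
    simpa using this
  have h5 (b c : ℕ) : F b c 0 = - F c 0 b := by
    linear_combination (norm := module) h4 c b - h3 b c
  refine ⟨h5, fun b c => ?_, fun b c d => ?_⟩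
  · linear_combination (norm := module) h3 b c - h5 b c
  · have := hR 0 b c d
    simp only [zero_add, add_zero] at this
    linear_combination (norm := module) this - h5 d (b + c)

/-- The element of `G` playing the role of `t^k ⊗ t^n dt`. -/
def formClass (F : ℕ → ℕ → ℕ → G) (k n : ℕ) : G := F k n 1 + F (n + 1) 0 k

lemma eq_formClass
    (hR : ∀ a b c d, F (a + b) c d + F d (c + a) b + F (b + c + a) 0 d + F d (b + c) a = 0)
    (hU : ∀ a, F 0 a 0 = 0) (k i j : ℕ) :
    F k i j = j • formClass F k (i + j - 1) - k • formClass F 0 (i + j + k - 1) := by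
  obtain ⟨h₁, h₂, h₃⟩ := relation_swap hR hU
  have key (k i j : ℕ) : F k i j = j • formClass F k (i + j - 1) - F (i + j) 0 k := by
    induction j generalizing i with
    | zero => simp [h₁ k i]
    | succ j ih =>
      have e₁ := hR 1 j i k
      have e₂ := h₃ (1 + j) i k
      have e₃ := ih (i + 1)
      rw [show i + 1 + j = i + j + 1 by ring] at e₃
      rw [show 1 + j = j + 1 by ring] at e₁ e₂
      rw [show j + i + 1 = i + j + 1 by ring, show j + i = i + j by ring] at e₁
      simp only [← add_assoc, Nat.add_sub_cancel, formClass] at e₃ ⊢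
      linear_combination (norm := module) e₂ - e₁ + e₃
  have h₄ (c : ℕ) : F c 0 0 = 0 := by rw [← h₂ 0 c, hU]
  have h₅ := key 0 (i + j) k
  rw [h₄, sub_zero, h₂] at h₅
  rw [key, h₅]

lemma exists_hom_of_two_nsmul_eq_zero (e : Fin 4 → G) (he : ∀ m, 2 • e m = 0) :
    ∃ ψ : (Fin 4 → ZMod 2) →+ G, ∀ m, ψ (Pi.single m 1) = e m := by
  let l (m : Fin 4) : ZMod 2 →+ G :=
    ZMod.lift 2 ⟨zmultiplesHom G (e m), by simpa [two_zsmul, two_nsmul] using he m⟩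
  refine ⟨∑ m, (l m).comp (Pi.evalAddMonoidHom _ m), fun m => ?_⟩
  rw [AddMonoidHom.finsetSum_apply, Finset.sum_eq_single m]
  · have := ZMod.lift_coe 2 ⟨zmultiplesHom G (e m), by simpa [two_zsmul, two_nsmul] using he m⟩ 1
    simpa [l] using this
  · intro i _ hi
    simp [Pi.single_eq_of_ne hi]
  · simp

lemma exists_hom_hsGen (x : ℕ → ℕ → G)
    (hl : ∀ k n, 4 ≤ k → x k n = 0) (hr : ∀ k n, 4 ≤ n → x k n = 0)
    (ht : ∀ k n, (n + 1) • x k n = 0)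
    (hs : ∀ k i j, j • x k (i + j - 1) + k • x j (i + k - 1) =
      (j + k) • x 0 (i + j + k - 1)) :
    ∃ ψ : (Fin 4 → ZMod 2) →+ G, ∀ k n, ψ (hsGen k n) = x k n := by
  have h0 (k : ℕ) : x k 0 = 0 := by simpa using ht k 0
  have h02 : x 0 2 = 0 := by
    linear_combination (norm := module) ht 0 2 - ht 1 1 + hs 1 1 1
  have h21 : x 2 1 = x 0 3 := by
    linear_combination (norm := module) 3 • hs 2 1 1 - 2 • ht 1 2 - ht 2 1 + 2 • ht 0 3
  have h12 : x 1 2 = 0 := by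
    linear_combination (norm := module) ht 1 2 - hs 2 1 1 - ht 0 3 + ht 2 1 - h21
  have h22 : x 2 2 = 0 := by
    linear_combination (norm := module) hs 2 1 2 + 4 • hr 0 4 le_rfl - ht 2 2
  have h23 : x 2 3 = 0 := by
    linear_combination (norm := module)
      3 • hs 2 1 3 + 15 • hr 0 5 (by simp) - 2 • ht 3 2 - 2 • ht 2 3
  have h32 : x 3 2 = 0 := by
    linear_combination (norm := module) ht 3 2 - hs 2 1 3 - 5 • hr 0 5 (by simp) + 3 • h23
  have h31 : x 3 1 = x 1 3 := by
    linear_combination (norm := module) hs 1 1 3 + 4 • hr 0 4 le_rfl - ht 1 3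
  have h33 : x 3 3 = 0 := by
    linear_combination (norm := module)
      hs 1 3 3 + 4 • hr 0 6 (by simp) - 3 • hr 1 5 (by simp)
  have t03 : 2 • x 0 3 = 0 := by rw [← h21]; exact ht 2 1
  have t13 : 2 • x 1 3 = 0 := by rw [← h31]; exact ht 3 1
  obtain ⟨ψ, hψ⟩ := exists_hom_of_two_nsmul_eq_zero ![x 0 1, x 0 3, x 1 1, x 1 3] (by
    intro m
    fin_cases m
    exacts [ht 0 1, t03, ht 1 1, t13])
  refine ⟨ψ, fun k n => ?_⟩
  rcases le_or_gt 4 k with hk | hk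
  · rw [hsGen_eq_zero_left n hk, hl k n hk, map_zero]
  rcases le_or_gt 4 n with hn | hn
  · rw [hsGen_eq_zero_right k hn, hr k n hn, map_zero]
  interval_cases k <;> interval_cases n <;>
    simp [hsGen, hψ, h0, h02, h21, h12, h22, h23, h32, h31, h33]

/-- A family satisfying the relations of `HS₁(ℤ[t]/(t⁴))` factors through `hsClass`. -/
lemma exists_hom_hsClass
    (hR : ∀ a b c d, F (a + b) c d + F d (c + a) b + F (b + c + a) 0 d + F d (b + c) a = 0)
    (hU : ∀ a, F 0 a 0 = 0) (hF : ∀ k i j, 4 ≤ k ∨ 4 ≤ i → F k i j = 0) :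
    ∃ ψ : (Fin 4 → ZMod 2) →+ G, ∀ k i j, ψ (hsClass k i j) = F k i j := by
  obtain ⟨h₁, h₂, h₃⟩ := relation_swap hR hU
  have hF' (k i : ℕ) (hk : 4 ≤ k) : F i 0 k = 0 := by
    rw [← neg_eq_zero, ← h₃, hF _ _ _ (Or.inl hk)]
  have hx := eq_formClass hR hU
  obtain ⟨ψ, hψ⟩ := exists_hom_hsGen (formClass F)
    (fun k n hk => by rw [formClass, hF _ _ _ (Or.inl hk), hF' _ _ hk, add_zero])
    (fun k n hn => by
      rw [formClass, hF _ _ _ (Or.inr hn), hF _ _ _ (Or.inl (by omega)), add_zero])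
    (fun k n => by
      have e₁ := hx k 0 (n + 1)
      have e₂ := hx 0 (n + 1) k
      simp only [zero_add, zero_smul, sub_zero, Nat.add_sub_cancel] at e₁ e₂
      linear_combination (norm := module) h₃ k 0 (n + 1) - e₁ + h₂ k (n + 1) - e₂)
    (fun k i j => by
      have e₁ := hx k i j
      have e₂ := hx j i k
      rw [show i + k + j = i + j + k by ring] at e₂
      linear_combination (norm := module) h₃ k i j - e₁ - e₂)
  exact ⟨ψ, fun k i j => by
    rw [hsClass, map_sub, map_nsmul, map_nsmul, hψ, hψ, ← hx]⟩

end Presentation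

lemma exists_basis_pow_adjoinRoot :
    ∃ (t : AdjoinRoot (Polynomial.X ^ 4 : Polynomial ℤ))
      (b : Module.Basis (Fin 4) ℤ (AdjoinRoot (Polynomial.X ^ 4 : Polynomial ℤ))), t ^ 4 = 0 ∧ ∀ i, b i = t ^ (i : ℕ) := by
  let p := AdjoinRoot.powerBasis' (Polynomial.monic_X_pow (R := ℤ) 4)
  have hp : p.dim = 4 := by simp [p]
  refine ⟨p.gen, p.basis.reindex (finCongr hp), ?_, fun i => ?_⟩
  · have := AdjoinRoot.mk_self (f := (Polynomial.X ^ 4 : Polynomial ℤ))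
    rw [map_pow] at this
    exact this
  · simp

lemma exists_basis_pow :
    ∃ (t : A) (b : Module.Basis (Fin 4) ℤ A), t ^ 4 = 0 ∧ ∀ i, b i = t ^ (i : ℕ) :=
  exists_basis_pow_adjoinRoot

section Homology

variable {R : Type*} [CommRing R] {t : R} (b : Module.Basis (Fin 4) ℤ R)

/-- The linear map sending `t^k ⊗ t^i ⊗ t^j` to `hsClass k i j`. -/
noncomputable def hsMap : R ⊗[ℤ] (R ⊗[ℤ] R) →ₗ[ℤ] (Fin 4 → ZMod 2) :=
  (b.tensorProduct (b.tensorProduct b)).constr ℤ fun m => hsClass m.1 m.2.1 m.2.2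

variable {b}

lemma hsMap_pow (ht : t ^ 4 = 0) (hb : ∀ i, b i = t ^ (i : ℕ)) (k i j : ℕ) :
    hsMap b ((t ^ k) ⊗ₜ ((t ^ i) ⊗ₜ (t ^ j))) = hsClass k i j := by
  by_cases h : 4 ≤ k ∨ 4 ≤ i ∨ 4 ≤ j
  · rw [hsClass_eq_zero h]
    rcases h with h | h | h <;> simp [pow_eq_zero_of_le h ht]
  · push Not at h
    have := (b.tensorProduct (b.tensorProduct b)).constr_basis ℤ
      (fun m => hsClass m.1 m.2.1 m.2.2) (⟨k, h.1⟩, ⟨i, h.2.1⟩, ⟨j, h.2.2⟩)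
    simp only [Module.Basis.tensorProduct_apply', hb] at this
    exact this

lemma hsMap_surjective (ht : t ^ 4 = 0) (hb : ∀ i, b i = t ^ (i : ℕ)) :
    Function.Surjective (hsMap b) := by
  have key (m : Fin 4) : ∃ y, hsMap b y = Pi.single m 1 := by
    have h (k i j : ℕ) (e : hsClass k i j = Pi.single m 1) : ∃ y, hsMap b y = Pi.single m 1 :=
      ⟨_, (hsMap_pow ht hb k i j).trans e⟩
    fin_cases m
    · exact h 0 1 1 (by decide)
    · exact h 2 1 1 (by decide)
    · exact h 1 1 1 (by decide)
    · exact h 3 1 1 (by decide)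
  choose y hy using key
  intro v
  refine ⟨∑ m, (v m).val • y m, ?_⟩
  simp only [map_sum, map_nsmul, hy]
  ext i
  simp only [Finset.sum_apply, Pi.smul_apply, Pi.single_apply, smul_ite, smul_zero,
    Finset.sum_ite_eq, Finset.mem_univ, if_true]
  simp

lemma ker_hsMap (ht : t ^ 4 = 0) (hb : ∀ i, b i = t ^ (i : ℕ))
    (d₂ : ((R ⊗[ℤ] (R ⊗[ℤ] (R ⊗[ℤ] R))) × R) →ₗ[ℤ] R ⊗[ℤ] (R ⊗[ℤ] R))
    (h₂ : ∀ a b c d : R, d₂ (a ⊗ₜ[ℤ] (b ⊗ₜ[ℤ] (c ⊗ₜ[ℤ] d)), 0) =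
      (a * b) ⊗ₜ[ℤ] (c ⊗ₜ[ℤ] d) + d ⊗ₜ[ℤ] ((c * a) ⊗ₜ[ℤ] b) +
        (b * c * a) ⊗ₜ[ℤ] ((1 : R) ⊗ₜ[ℤ] d) + d ⊗ₜ[ℤ] ((b * c) ⊗ₜ[ℤ] a))
    (h₃ : ∀ a : R, d₂ (0, a) = (1 : R) ⊗ₜ[ℤ] (a ⊗ₜ[ℤ] (1 : R))) :
    LinearMap.ker (hsMap b) = LinearMap.range d₂ := by
  have e₂ (a b c d : ℕ) : d₂ ((t ^ a) ⊗ₜ[ℤ] ((t ^ b) ⊗ₜ[ℤ] ((t ^ c) ⊗ₜ[ℤ] (t ^ d))), 0) =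
      (t ^ (a + b)) ⊗ₜ[ℤ] ((t ^ c) ⊗ₜ[ℤ] (t ^ d)) +
        (t ^ d) ⊗ₜ[ℤ] ((t ^ (c + a)) ⊗ₜ[ℤ] (t ^ b)) +
        (t ^ (b + c + a)) ⊗ₜ[ℤ] ((t ^ 0) ⊗ₜ[ℤ] (t ^ d)) +
        (t ^ d) ⊗ₜ[ℤ] ((t ^ (b + c)) ⊗ₜ[ℤ] (t ^ a)) := by
    simp only [h₂, pow_add, pow_zero]
  have e₃ (a : ℕ) : d₂ (0, t ^ a) = (t ^ 0) ⊗ₜ[ℤ] ((t ^ a) ⊗ₜ[ℤ] (t ^ 0)) := by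
    simp only [h₃, pow_zero]
  apply le_antisymm
  · let q := (LinearMap.range d₂).mkQ
    have hq (y) : q (d₂ y) = 0 := by simp [q]
    obtain ⟨ψ, hψ⟩ := exists_hom_hsClass
      (F := fun k i j => q ((t ^ k) ⊗ₜ[ℤ] ((t ^ i) ⊗ₜ[ℤ] (t ^ j))))
      (fun a b c d => by simp only [← map_add, ← e₂, hq])
      (fun a => by simp only [← e₃, hq])
      (fun k i j h => by rcases h with h | h <;> simp [pow_eq_zero_of_le h ht])
    have hcomp : ψ.toIntLinearMap ∘ₗ hsMap b = q := by
      refine (b.tensorProduct (b.tensorProduct b)).ext fun m => ?_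
      simp only [Module.Basis.tensorProduct_apply', hb]
      exact (congrArg ψ (hsMap_pow ht hb _ _ _)).trans (hψ _ _ _)
    intro y hy
    rw [← Submodule.ker_mkQ (LinearMap.range d₂), LinearMap.mem_ker]
    change q y = 0
    rw [← hcomp, LinearMap.comp_apply, LinearMap.mem_ker.mp hy, map_zero]
  · rw [LinearMap.range_le_ker_iff]
    refine LinearMap.prod_ext ?_ ?_
    · refine (b.tensorProduct (b.tensorProduct (b.tensorProduct b))).ext fun m => ?_
      simp only [Module.Basis.tensorProduct_apply', hb]
      refine (congrArg (hsMap b) (e₂ _ _ _ _)).trans ?_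
      simp only [map_add, hsMap_pow ht hb]
      exact hsClass_relation _ _ _ _
    · refine b.ext fun m => ?_
      simp only [hb, LinearMap.comp_apply, LinearMap.inr_apply, e₃, hsMap_pow ht hb]
      exact hsClass_unit _

end Homology

/-- HS₁(ℤ[t]/(t⁴)) ≅ (ℤ/2ℤ)⁴: the first homology `ker ∂₁ / im ∂₂` of the partial complex is isomorphic as an abelian group to `(ℤ/2ℤ)⁴`. -/
theorem HS1_int_t_fourth
    (d₁ : A ⊗[ℤ] (A ⊗[ℤ] A) →ₗ[ℤ] A)
    (d₂ : ((A ⊗[ℤ] (A ⊗[ℤ] (A ⊗[ℤ] A))) × A) →ₗ[ℤ] A ⊗[ℤ] (A ⊗[ℤ] A))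
    (h₁ : ∀ a b c : A, d₁ (a ⊗ₜ[ℤ] (b ⊗ₜ[ℤ] c)) = a * b * c - c * b * a)
    (h₂ : ∀ a b c d : A, d₂ (a ⊗ₜ[ℤ] (b ⊗ₜ[ℤ] (c ⊗ₜ[ℤ] d)), 0) =
      (a * b) ⊗ₜ[ℤ] (c ⊗ₜ[ℤ] d) + d ⊗ₜ[ℤ] ((c * a) ⊗ₜ[ℤ] b) +
        (b * c * a) ⊗ₜ[ℤ] ((1 : A) ⊗ₜ[ℤ] d) + d ⊗ₜ[ℤ] ((b * c) ⊗ₜ[ℤ] a))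
    (h₃ : ∀ a : A, d₂ (0, a) = (1 : A) ⊗ₜ[ℤ] (a ⊗ₜ[ℤ] (1 : A))) :
    Nonempty
      ((↥(LinearMap.ker d₁) ⧸
          Submodule.comap (LinearMap.ker d₁).subtype (LinearMap.range d₂)) ≃+
        (Fin 4 → ZMod 2)) := by
  obtain ⟨t, b, ht, hb⟩ := exists_basis_pow
  have hd₁ : d₁ = 0 := by
    refine (b.tensorProduct (b.tensorProduct b)).ext fun m => ?_
    simp only [Module.Basis.tensorProduct_apply']
    exact (h₁ _ _ _).trans (sub_eq_zero.mpr (by ring))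
  subst hd₁
  let f := (hsMap b).comp (LinearMap.ker (0 : A ⊗[ℤ] (A ⊗[ℤ] A) →ₗ[ℤ] A)).subtype
  have hf : Function.Surjective f := fun v => by
    obtain ⟨y, hy⟩ := hsMap_surjective ht hb v
    exact ⟨⟨y, by simp⟩, hy⟩
  have hker : Submodule.comap (LinearMap.ker (0 : A ⊗[ℤ] (A ⊗[ℤ] A) →ₗ[ℤ] A)).subtype
      (LinearMap.range d₂) = LinearMap.ker f := by
    rw [← ker_hsMap ht hb d₂ h₂ h₃, LinearMap.ker_comp]
  exact ⟨((Submodule.quotEquivOfEq _ _ hker).trans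
    (f.quotKerEquivOfSurjective hf)).toAddEquiv⟩
end

section
/- For the commutative ring A = ℤ[t]/(t⁴), the first homology H₁ = ker ∂₁ / im ∂₂ of the partial complex, equipped with its A-module structure [a]·[x⊗y⊗z] = [ax⊗y⊗z − x⊗ya⊗z + x⊗y⊗az], is a cyclic A-module: it is generated by a single element u satisfying 2u = 0, and is isomorphic as an A-module to A/2A. -/
open TensorProduct

set_option synthInstance.maxHeartbeats 1000000
set_option maxHeartbeats 1000000

/-- The class `t` of the variable in `A = ℤ[t]/(t⁴)`. -/
noncomputable abbrev tA : A :=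
  Ideal.Quotient.mk (Ideal.span ({Polynomial.X ^ 4} : Set (Polynomial ℤ))) Polynomial.X

theorem smul_eq_smul_of_two_smul_eq_zero {Q : Type*} [AddCommGroup Q] {x : Q}
    (hx : (2 : ℤ) • x = 0) {a b : ℤ} (hab : (a : ZMod 2) = b) : a • x = b • x := by
  obtain ⟨c, hc⟩ := (ZMod.intCast_eq_intCast_iff_dvd_sub a b 2).1 hab
  obtain rfl : b = a + 2 * c := by push_cast at hc; linarith
  rw [add_smul, mul_comm, mul_smul, hx, smul_zero, add_zero]

/-- Maps killing the image of the second differential of the partial symmetric complex. -/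
structure IsSymmCocycle {R Q : Type*} [CommMonoid R] [AddCommGroup Q] (q : R → R → R → Q) :
    Prop where
  one_left_right (a : R) : q 1 a 1 = 0
  rel (a b c d : R) :
    q (a * b) c d + q d (c * a) b + q (b * c * a) 1 d + q d (b * c) a = 0

theorem map_pow_mul_of_derivation_rule {R Q : Type*} [CommMonoid R] [AddCommGroup Q]
    {f : R → R → Q} (hf : ∀ a b c, f (a * b) c = f a (b * c) + f b (a * c)) (t c : R) (n : ℕ) :
    f (t ^ (n + 1)) c = ((n : ℤ) + 1) • f t (t ^ n * c) := by
  induction n generalizing c with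
  | zero => simp
  | succ n ih =>
    rw [pow_succ, hf, ih, ← mul_assoc, ← pow_succ]
    push_cast
    module

namespace IsSymmCocycle

variable {R Q : Type*} [CommMonoid R] [AddCommGroup Q] {q : R → R → R → Q}

theorem one_right (hq : IsSymmCocycle q) (c : R) : q c 1 1 = 0 := by
  have h := hq.rel 1 1 c 1
  simpa [hq.one_left_right] using h

theorem one_left (hq : IsSymmCocycle q) (c : R) : q 1 1 c = 0 := by
  have h := hq.rel c 1 1 1
  simpa [hq.one_left_right, hq.one_right] using h

theorem one_antisymm (hq : IsSymmCocycle q) (a b : R) : q 1 b a = -q 1 a b := by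
  have h := hq.rel a b 1 1
  simp only [mul_one, one_mul, hq.one_right, add_zero] at h
  linear_combination (norm := module) h

theorem right_one (hq : IsSymmCocycle q) (a b : R) : q a b 1 = q 1 a b := by
  have h := hq.rel 1 a b 1
  simp only [mul_one, one_mul, hq.one_right, hq.one_left_right, add_zero] at h
  rw [hq.one_antisymm a b] at h
  linear_combination (norm := module) h

theorem middle_one (hq : IsSymmCocycle q) (a b : R) : q a 1 b = q 1 a b := by
  have h := hq.rel 1 1 a b
  simp only [mul_one, one_mul, hq.right_one] at h
  rw [hq.one_antisymm a b] at h
  linear_combination (norm := module) h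

theorem antisymm_outer (hq : IsSymmCocycle q) (a b c : R) : q c b a = -q a b c := by
  have h := hq.rel 1 a b c
  simp only [mul_one, one_mul, hq.right_one, hq.middle_one] at h
  rw [hq.one_antisymm (a * b) c] at h
  linear_combination (norm := module) h

theorem swap_right (hq : IsSymmCocycle q) (a b c : R) :
    q a c b = -q a b c - (2 : ℤ) • q 1 (b * c) a := by
  have h := hq.rel b c 1 a
  simp only [mul_one, one_mul, hq.middle_one, mul_comm c b] at h
  linear_combination (norm := module) h

theorem one_derivation_rule (hq : IsSymmCocycle q) (a b c : R) :
    q 1 c (a * b) = q 1 (b * c) a + q 1 (a * c) b := by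
  have h := hq.rel a b c 1
  simp only [hq.right_one, hq.one_left, mul_comm c a, add_zero] at h
  rw [hq.one_antisymm (a * b) c]
  linear_combination (norm := module) -h

/-- The correction of `q` that is a derivation in its first argument. -/
def bracket (q : R → R → R → Q) (x c d : R) : Q := q x c d - q 1 (x * c) d

theorem bracket_one (x d : R) : bracket q 1 x d = 0 := by
  simp [bracket]

theorem bracket_derivation_rule (hq : IsSymmCocycle q) (a b c d : R) :
    bracket q (a * b) c d = bracket q a (b * c) d + bracket q b (a * c) d := by
  have h := hq.rel a b c d
  rw [hq.antisymm_outer b, hq.antisymm_outer a, hq.middle_one, mul_comm (b * c) a,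
    mul_comm c a] at h
  rw [bracket, bracket, bracket, mul_left_comm b, mul_assoc a]
  linear_combination (norm := module) h

theorem bracket_antisymm (hq : IsSymmCocycle q) (a b c : R) :
    bracket q b a c = -bracket q a b c := by
  have h₁ := hq.swap_right a b c
  have h₂ := hq.antisymm_outer a c b
  have h₃ := hq.swap_right b a c
  have h₄ := hq.one_derivation_rule a b c
  have h₅ := hq.one_antisymm (a * b) c
  rw [bracket, bracket, mul_comm b a]
  linear_combination (norm := module) h₁ - h₂ + h₃ + (2 : ℤ) • h₄ - (2 : ℤ) • h₅

theorem bracket_outer (hq : IsSymmCocycle q) (a b c : R) :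
    bracket q a b c + bracket q c b a = q 1 (a * c) b := by
  have h₁ := hq.antisymm_outer a b c
  have h₂ := hq.one_derivation_rule a c b
  have h₃ := hq.one_antisymm (a * c) b
  rw [bracket, bracket]
  linear_combination (norm := module) h₁ + h₂ - h₃

variable (t : R)

theorem one_pow_pow (hq : IsSymmCocycle q) (i j : ℕ) :
    q 1 (t ^ i) (t ^ j) = (j : ℤ) • q 1 (t ^ (i + j - 1)) t := by
  cases j with
  | zero => simp [hq.one_left_right]
  | succ j =>
    have h := map_pow_mul_of_derivation_rule (f := fun x c => q 1 c x)
      (fun a b c => hq.one_derivation_rule a b c) t (t ^ i) j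
    simpa [← pow_add, add_comm j i, ← add_assoc] using h

theorem bracket_pow_pow (hq : IsSymmCocycle q) (n m : ℕ) (d : R) :
    bracket q (t ^ n) (t ^ m) d = (n : ℤ) • bracket q t (t ^ (n + m - 1)) d := by
  cases n with
  | zero => simp [bracket_one]
  | succ n =>
    have h := map_pow_mul_of_derivation_rule (f := fun x c => bracket q x c d)
      (fun a b c => hq.bracket_derivation_rule a b c d) t (t ^ m) n
    have e : n + 1 + m - 1 = n + m := by omega
    simpa [← pow_add, e] using h

theorem bracket_pow_right (hq : IsSymmCocycle q) (m k : ℕ) :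
    bracket q t (t ^ m) (t ^ k) =
      (m : ℤ) • q 1 (t ^ (m + k)) t - (k : ℤ) • bracket q t (t ^ (m + k - 1)) t := by
  have h₁ := hq.bracket_outer t (t ^ m) (t ^ k)
  have h₂ := hq.bracket_pow_pow t k m t
  have h₃ := hq.one_pow_pow t (k + 1) m
  rw [← pow_succ', h₃, h₂, add_comm k m] at h₁
  have e : k + 1 + m - 1 = m + k := by omega
  rw [e] at h₁
  linear_combination (norm := module) h₁

theorem pow_pow_pow (hq : IsSymmCocycle q) (n m k : ℕ) :
    q (t ^ n) (t ^ m) (t ^ k) = (n * (n + m - 1) + k : ℤ) • q 1 (t ^ (n + m + k - 1)) t -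
      (n * k : ℤ) • bracket q t (t ^ (n + m + k - 2)) t := by
  have h : q (t ^ n) (t ^ m) (t ^ k) =
      bracket q (t ^ n) (t ^ m) (t ^ k) + q 1 (t ^ (n + m)) (t ^ k) := by
    rw [bracket, pow_add]; abel
  rw [h, hq.one_pow_pow, hq.bracket_pow_pow]
  rcases Nat.eq_zero_or_pos n with rfl | hn
  · simp
  · obtain ⟨s, hs⟩ : ∃ s, n + m = s + 1 := ⟨n + m - 1, by omega⟩
    have hs' : (n : ℤ) + m = s + 1 := by exact_mod_cast hs
    have e₁ : s + 1 + k - 1 = s + k := by omega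
    have e₂ : s + 1 + k - 2 = s + k - 1 := by omega
    rw [hs, Nat.add_sub_cancel, hq.bracket_pow_right, hs', e₁, e₂]
    module

theorem add_two_smul_one_pow (hq : IsSymmCocycle q) (M : ℕ) :
    ((M : ℤ) + 2) • q 1 (t ^ (M + 1)) t = 0 := by
  have h₁ := hq.one_pow_pow t 1 (M + 1)
  have h₂ := hq.one_antisymm t (t ^ (M + 1))
  have e : 1 + (M + 1) - 1 = M + 1 := by omega
  rw [pow_one, e] at h₁
  push_cast at h₁
  linear_combination (norm := module) -h₁ + h₂

theorem add_one_smul_bracket (hq : IsSymmCocycle q) (m : ℕ) (d : R) :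
    ((m : ℤ) + 1) • bracket q t (t ^ m) d = 0 := by
  have h₁ := hq.bracket_pow_pow t m 1 d
  have h₂ := hq.bracket_antisymm t (t ^ m) d
  rw [pow_one, Nat.add_sub_cancel] at h₁
  linear_combination (norm := module) -h₁ + h₂

theorem two_smul_bracket (hq : IsSymmCocycle q) (M : ℕ) :
    (2 : ℤ) • bracket q t (t ^ M) t = (M : ℤ) • q 1 (t ^ (M + 1)) t := by
  have h := hq.bracket_pow_right t M 1
  simp only [pow_one, Nat.add_sub_cancel, Nat.cast_one, one_smul] at h
  linear_combination (norm := module) h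

theorem two_smul_one_pow (hq : IsSymmCocycle q) (M : ℕ) :
    (2 : ℤ) • q 1 (t ^ (M + 1)) t = 0 := by
  have h := hq.add_two_smul_one_pow t M
  cases M with
  | zero => simpa using h
  | succ j =>
    have h₁ := hq.add_one_smul_bracket t j (t ^ 2)
    have h₂ := hq.bracket_pow_right t j 2
    have h₃ := hq.two_smul_bracket t (j + 1)
    have e : j + 2 - 1 = j + 1 := by omega
    rw [e] at h₂
    push_cast at h h₂ h₃
    linear_combination (norm := module) h + h₁ - ((j : ℤ) + 1) • h₂ + ((j : ℤ) + 1) • h₃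

theorem two_smul_bracket_eq_zero (hq : IsSymmCocycle q) (M : ℕ) :
    (2 : ℤ) • bracket q t (t ^ M) t = 0 := by
  linear_combination (norm := module) hq.two_smul_bracket t M + hq.add_two_smul_one_pow t M -
    hq.two_smul_one_pow t M

theorem two_smul_self_self_pow (hq : IsSymmCocycle q) (M : ℕ) :
    (2 : ℤ) • q t t (t ^ M) = 0 := by
  have h := hq.pow_pow_pow t 1 1 M
  have e₁ : 1 + 1 + M - 1 = M + 1 := by omega
  have e₂ : 1 + 1 + M - 2 = M := by omega
  rw [pow_one, e₁, e₂] at h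
  rw [h, smul_sub, smul_comm (2 : ℤ), hq.two_smul_one_pow, smul_comm (2 : ℤ),
    hq.two_smul_bracket_eq_zero, smul_zero, smul_zero, sub_zero]

theorem pow_pow_pow_eq_smul (hq : IsSymmCocycle q) (n m k : ℕ) :
    q (t ^ n) (t ^ m) (t ^ k) = (n * m + n * k + m * k : ℤ) • q t t (t ^ (n + m + k - 2)) := by
  rcases Nat.lt_or_ge (n + m + k) 2 with hlt | hge
  · obtain ⟨rfl, rfl⟩ | ⟨rfl, rfl⟩ | ⟨rfl, rfl⟩ :
        n = 0 ∧ m = 0 ∨ n = 0 ∧ k = 0 ∨ m = 0 ∧ k = 0 := by omega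
    · simp [hq.one_left]
    · simp [hq.one_left_right]
    · simp [hq.one_right]
  obtain ⟨M, hM⟩ : ∃ M, n + m + k = M + 2 := ⟨n + m + k - 2, by omega⟩
  have hgen := hq.pow_pow_pow t 1 1 M
  have e₁ : 1 + 1 + M - 1 = M + 1 := by omega
  have e₂ : 1 + 1 + M - 2 = M := by omega
  have e₃ : M + 2 - 1 = M + 1 := by omega
  rw [pow_one, e₁, e₂] at hgen
  rw [hq.pow_pow_pow, hM, Nat.add_sub_cancel, e₃, hgen]
  have hh := hq.two_smul_one_pow t M
  have hh' := hq.add_two_smul_one_pow t M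
  have hw' := hq.add_one_smul_bracket t M t
  have hw := hq.two_smul_bracket_eq_zero t M
  generalize q 1 (t ^ (M + 1)) t = h at *
  generalize bracket q t (t ^ M) t = w at *
  have hk : (k : ZMod 2) = M + n + m := by
    have := congrArg (Nat.cast : ℕ → ZMod 2) hM
    push_cast at this
    generalize (n : ZMod 2) = n at *
    generalize (m : ZMod 2) = m at *
    generalize (k : ZMod 2) = k at *
    generalize (M : ZMod 2) = M at *
    revert n m k M
    decide
  have hcases : (M : ZMod 2) = 0 ∧ w = 0 ∨ (M : ZMod 2) = 1 ∧ h = 0 := by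
    rcases Nat.even_or_odd M with ⟨j, rfl⟩ | ⟨j, rfl⟩
    · refine Or.inl ⟨by push_cast; exact CharTwo.add_self_eq_zero _, ?_⟩
      push_cast at hw'
      linear_combination (norm := module) hw' - (j : ℤ) • hw
    · refine Or.inr ⟨?_, ?_⟩
      · push_cast
        rw [(CharTwo.two_eq_zero : (2 : ZMod 2) = 0), zero_mul, zero_add]
      · push_cast at hh'
        linear_combination (norm := module) hh' - ((j : ℤ) + 1) • hh
  rcases hcases with ⟨hM', rfl⟩ | ⟨hM', rfl⟩
  · simp only [smul_zero, sub_zero, smul_smul]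
    refine smul_eq_smul_of_two_smul_eq_zero hh ?_
    push_cast
    rw [hk, hM']
    generalize (n : ZMod 2) = n
    generalize (m : ZMod 2) = m
    revert n m
    decide
  · simp only [smul_zero, zero_sub, smul_smul, ← neg_smul]
    refine smul_eq_smul_of_two_smul_eq_zero hw ?_
    push_cast
    rw [hk, hM']
    generalize (n : ZMod 2) = n
    generalize (m : ZMod 2) = m
    revert n m
    decide

end IsSymmCocycle

theorem tA_pow_four : tA ^ 4 = 0 := by
  rw [← map_pow]
  exact Ideal.Quotient.eq_zero_iff_mem.2 (Ideal.mem_span_singleton_self _)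

theorem A.linearMap_ext {N : Type*} [AddCommGroup N] {f g : A →ₗ[ℤ] N}
    (h : ∀ n : ℕ, f (tA ^ n) = g (tA ^ n)) : f = g := by
  refine LinearMap.ext fun a => ?_
  obtain ⟨p, rfl⟩ := Ideal.Quotient.mk_surjective a
  induction p using Polynomial.induction_on' with
  | add p r hp hr => rw [map_add, map_add, map_add, hp, hr]
  | monomial n c =>
    rw [← mul_one c, ← smul_eq_mul, ← Polynomial.smul_monomial, map_zsmul, map_zsmul, map_zsmul,
      Polynomial.monomial_one_right_eq_X_pow, map_pow, h]

theorem A.tensor_linearMap_ext {N : Type*} [AddCommGroup N] {f g : A ⊗[ℤ] (A ⊗[ℤ] A) →ₗ[ℤ] N}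
    (h : ∀ n m k : ℕ, f ((tA ^ n) ⊗ₜ[ℤ] ((tA ^ m) ⊗ₜ[ℤ] (tA ^ k))) =
      g ((tA ^ n) ⊗ₜ[ℤ] ((tA ^ m) ⊗ₜ[ℤ] (tA ^ k)))) : f = g :=
  TensorProduct.ext <| A.linearMap_ext fun n => TensorProduct.ext <| A.linearMap_ext fun m =>
    A.linearMap_ext fun k => h n m k

section Derivative

variable {B : Type*} [CommRing B]

theorem inl_add_eps_pow_four (h2 : (2 : B) = 0) {x : B} (hx : x ^ 4 = 0) :
    (TrivSqZeroExt.inl x + DualNumber.eps : DualNumber B) ^ 4 = 0 := by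
  have h2' : (2 : DualNumber B) = 0 := by
    have h := congrArg (algebraMap B (DualNumber B)) h2
    rwa [map_ofNat, map_zero] at h
  have hx' : (TrivSqZeroExt.inl x : DualNumber B) ^ 4 = 0 := by
    have h := congrArg (algebraMap B (DualNumber B)) hx
    rwa [map_pow, map_zero] at h
  have he : (DualNumber.eps : DualNumber B) * DualNumber.eps = 0 := DualNumber.eps_mul_eps
  generalize (TrivSqZeroExt.inl x : DualNumber B) = y at *
  generalize (DualNumber.eps : DualNumber B) = e at *
  linear_combination hx' + 2 * y ^ 3 * e * h2' + (6 * y ^ 2 + 4 * y * e + e ^ 2) * he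

variable (f : A →+* B) (h2 : (2 : B) = 0)

/-- The ring homomorphism `a ↦ f a + (f a)' ε` to the dual numbers. -/
noncomputable def dualLift : A →+* DualNumber B :=
  Ideal.Quotient.lift _
    (Polynomial.eval₂RingHom (Int.castRingHom (DualNumber B))
      (TrivSqZeroExt.inl (f tA) + DualNumber.eps)) <| by
    intro p hp
    obtain ⟨r, rfl⟩ := Ideal.mem_span_singleton'.1 hp
    rw [map_mul, map_pow, Polynomial.coe_eval₂RingHom, Polynomial.eval₂_X,
      inl_add_eps_pow_four h2 (by rw [← map_pow, tA_pow_four, map_zero]), mul_zero]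

theorem dualLift_tA : dualLift f h2 tA = TrivSqZeroExt.inl (f tA) + DualNumber.eps :=
  Polynomial.eval₂_X _ _

theorem fst_dualLift (a : A) : (dualLift f h2 a).fst = f a := by
  have h : (TrivSqZeroExt.fstHom B B B).toRingHom.comp (dualLift f h2) = f := by
    refine Ideal.Quotient.ringHom_ext (Polynomial.ringHom_ext (fun n => by simp) ?_)
    change (dualLift f h2 tA).fst = f tA
    rw [dualLift_tA]
    simp
  exact congrArg (fun g : A →+* B => g a) h

/-- The derivative along a ring homomorphism to a ring of characteristic two, in which `4 = 0`. -/
noncomputable def derivAlong : A →ₗ[ℤ] B :=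
  ((TrivSqZeroExt.sndHom B B).toAddMonoidHom.comp
    (dualLift f h2).toAddMonoidHom).toIntLinearMap

theorem derivAlong_apply (a : A) : derivAlong f h2 a = (dualLift f h2 a).snd := rfl

theorem derivAlong_mul (a b : A) :
    derivAlong f h2 (a * b) = f a * derivAlong f h2 b + f b * derivAlong f h2 a := by
  simp only [derivAlong_apply, map_mul, DualNumber.snd_mul, fst_dualLift]
  ring

theorem derivAlong_one : derivAlong f h2 1 = 0 := by
  rw [derivAlong_apply, map_one, TrivSqZeroExt.snd_one]

theorem derivAlong_tA : derivAlong f h2 tA = 1 := by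
  rw [derivAlong_apply, dualLift_tA]
  simp

/-- The map `x ⊗ y ⊗ z ↦ f x * (g y * h z)`. -/
noncomputable def tripleMul (f g h : A →ₗ[ℤ] B) : A ⊗[ℤ] (A ⊗[ℤ] A) →ₗ[ℤ] B :=
  LinearMap.mul' ℤ B ∘ₗ TensorProduct.map f (LinearMap.mul' ℤ B ∘ₗ TensorProduct.map g h)

/-- The map `x ⊗ y ⊗ z ↦ x y' z' + x' y z' + x' y' z`, which for `B = A / 2A` induces the
isomorphism from the first homology to `A / 2A`. -/
noncomputable def homologyMap : A ⊗[ℤ] (A ⊗[ℤ] A) →ₗ[ℤ] B :=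
  tripleMul f.toAddMonoidHom.toIntLinearMap (derivAlong f h2) (derivAlong f h2) +
    tripleMul (derivAlong f h2) f.toAddMonoidHom.toIntLinearMap (derivAlong f h2) +
    tripleMul (derivAlong f h2) (derivAlong f h2) f.toAddMonoidHom.toIntLinearMap

theorem homologyMap_tmul (x y z : A) :
    homologyMap f h2 (x ⊗ₜ[ℤ] (y ⊗ₜ[ℤ] z)) =
      f x * (derivAlong f h2 y * derivAlong f h2 z) +
      derivAlong f h2 x * (f y * derivAlong f h2 z) +
      derivAlong f h2 x * (derivAlong f h2 y * f z) := rfl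

theorem homologyMap_self_self (a : A) :
    homologyMap f h2 (tA ⊗ₜ[ℤ] (tA ⊗ₜ[ℤ] a)) = f a := by
  rw [homologyMap_tmul, derivAlong_tA]
  linear_combination (f tA * derivAlong f h2 a) * h2

theorem homologyMap_smul (a x y z : A) :
    homologyMap f h2 ((a * x) ⊗ₜ[ℤ] (y ⊗ₜ[ℤ] z) - x ⊗ₜ[ℤ] ((y * a) ⊗ₜ[ℤ] z) +
      x ⊗ₜ[ℤ] (y ⊗ₜ[ℤ] (a * z))) =
      f a * homologyMap f h2 (x ⊗ₜ[ℤ] (y ⊗ₜ[ℤ] z)) := by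
  simp only [map_add, map_sub, homologyMap_tmul, derivAlong_mul, map_mul]
  linear_combination (f x * derivAlong f h2 y * derivAlong f h2 a * f z) * h2

theorem homologyMap_relation (a b c d : A) :
    homologyMap f h2 ((a * b) ⊗ₜ[ℤ] (c ⊗ₜ[ℤ] d) + d ⊗ₜ[ℤ] ((c * a) ⊗ₜ[ℤ] b) +
      (b * c * a) ⊗ₜ[ℤ] ((1 : A) ⊗ₜ[ℤ] d) + d ⊗ₜ[ℤ] ((b * c) ⊗ₜ[ℤ] a)) = 0 := by
  simp only [map_add, homologyMap_tmul, derivAlong_mul, map_mul, derivAlong_one, map_one]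
  generalize derivAlong f h2 = D
  linear_combination (2 * f a * f b * D c * D d + f a * D c * D b * f d +
    2 * f a * D d * D b * f c + f b * D c * D a * f d + 2 * f b * D d * D a * f c +
    D b * D a * f c * f d) * h2

theorem homologyMap_one_left_right (a : A) :
    homologyMap f h2 ((1 : A) ⊗ₜ[ℤ] (a ⊗ₜ[ℤ] (1 : A))) = 0 := by
  rw [homologyMap_tmul, derivAlong_one]
  ring

theorem homologyMap_surjective (hf : Function.Surjective f) :
    Function.Surjective (homologyMap f h2) := fun b => by
  obtain ⟨a, rfl⟩ := hf b
  exact ⟨_, homologyMap_self_self f h2 a⟩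

theorem range_le_ker_homologyMap
    (d₂ : ((A ⊗[ℤ] (A ⊗[ℤ] (A ⊗[ℤ] A))) × A) →ₗ[ℤ] A ⊗[ℤ] (A ⊗[ℤ] A))
    (hd : ∀ a b c d : A, d₂ (a ⊗ₜ[ℤ] (b ⊗ₜ[ℤ] (c ⊗ₜ[ℤ] d)), 0) =
      (a * b) ⊗ₜ[ℤ] (c ⊗ₜ[ℤ] d) + d ⊗ₜ[ℤ] ((c * a) ⊗ₜ[ℤ] b) +
        (b * c * a) ⊗ₜ[ℤ] ((1 : A) ⊗ₜ[ℤ] d) + d ⊗ₜ[ℤ] ((b * c) ⊗ₜ[ℤ] a))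
    (hd' : ∀ a : A, d₂ (0, a) = (1 : A) ⊗ₜ[ℤ] (a ⊗ₜ[ℤ] (1 : A))) :
    LinearMap.range d₂ ≤ LinearMap.ker (homologyMap f h2) := by
  have hzero : homologyMap f h2 ∘ₗ d₂ = 0 := by
    refine LinearMap.prod_ext (TensorProduct.ext <| LinearMap.ext fun a =>
      TensorProduct.ext_threefold' fun b c d => ?_) (LinearMap.ext fun a => ?_)
    · exact (congrArg (homologyMap f h2) (hd a b c d)).trans (homologyMap_relation f h2 a b c d)
    · exact (congrArg (homologyMap f h2) (hd' a)).trans (homologyMap_one_left_right f h2 a)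
  exact LinearMap.range_le_ker_iff.2 hzero

theorem ker_homologyMap_le (hf : ∀ a, f a = 0 → a ∈ Ideal.span ({2} : Set A))
    (W : Submodule ℤ (A ⊗[ℤ] (A ⊗[ℤ] A)))
    (hW : IsSymmCocycle fun x y z : A => W.mkQ (x ⊗ₜ[ℤ] (y ⊗ₜ[ℤ] z)))
    (hle : W ≤ LinearMap.ker (homologyMap f h2)) :
    LinearMap.ker (homologyMap f h2) ≤ W := by
  let G : A →ₗ[ℤ] (A ⊗[ℤ] (A ⊗[ℤ] A)) ⧸ W :=
    W.mkQ ∘ₗ TensorProduct.mk ℤ A (A ⊗[ℤ] A) tA ∘ₗ TensorProduct.mk ℤ A A tA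
  have hG_two : (2 : ℤ) • G = 0 := A.linearMap_ext fun n => hW.two_smul_self_self_pow tA n
  have hG_range : (LinearMap.range G).mkQ ∘ₗ W.mkQ = 0 := A.tensor_linearMap_ext fun n m k =>
    (Submodule.Quotient.mk_eq_zero _).2
      ⟨_, (map_zsmul G _ _).trans (hW.pow_pow_pow_eq_smul tA n m k).symm⟩
  intro m hm
  obtain ⟨a, ha⟩ : W.mkQ m ∈ LinearMap.range G :=
    (Submodule.Quotient.mk_eq_zero _).1 (LinearMap.congr_fun hG_range m)
  have hfa : f a = 0 := by
    rw [← homologyMap_self_self f h2 a, ← LinearMap.mem_ker,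
      ← sub_add_cancel (tA ⊗ₜ[ℤ] (tA ⊗ₜ[ℤ] a)) m]
    exact add_mem (hle ((Submodule.Quotient.eq W).1 ha)) hm
  obtain ⟨b, rfl⟩ := Ideal.mem_span_singleton'.1 (hf a hfa)
  rw [mul_two, map_add, ← two_zsmul] at ha
  exact (Submodule.Quotient.mk_eq_zero W).1 (ha.symm.trans (LinearMap.congr_fun hG_two b))

theorem ker_homologyMap_eq_range (hf : ∀ a, f a = 0 → a ∈ Ideal.span ({2} : Set A))
    (d₂ : ((A ⊗[ℤ] (A ⊗[ℤ] (A ⊗[ℤ] A))) × A) →ₗ[ℤ] A ⊗[ℤ] (A ⊗[ℤ] A))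
    (hd : ∀ a b c d : A, d₂ (a ⊗ₜ[ℤ] (b ⊗ₜ[ℤ] (c ⊗ₜ[ℤ] d)), 0) =
      (a * b) ⊗ₜ[ℤ] (c ⊗ₜ[ℤ] d) + d ⊗ₜ[ℤ] ((c * a) ⊗ₜ[ℤ] b) +
        (b * c * a) ⊗ₜ[ℤ] ((1 : A) ⊗ₜ[ℤ] d) + d ⊗ₜ[ℤ] ((b * c) ⊗ₜ[ℤ] a))
    (hd' : ∀ a : A, d₂ (0, a) = (1 : A) ⊗ₜ[ℤ] (a ⊗ₜ[ℤ] (1 : A))) :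
    LinearMap.ker (homologyMap f h2) = LinearMap.range d₂ := by
  have hle := range_le_ker_homologyMap f h2 d₂ hd hd'
  refine le_antisymm (ker_homologyMap_le f h2 hf _ ⟨fun a => ?_, fun a b c d => ?_⟩ hle) hle
  · exact (Submodule.Quotient.mk_eq_zero _).2 ⟨(0, a), hd' a⟩
  · simp only [← map_add]
    exact (Submodule.Quotient.mk_eq_zero _).2 ⟨(a ⊗ₜ[ℤ] (b ⊗ₜ[ℤ] (c ⊗ₜ[ℤ] d)), 0), hd a b c d⟩

theorem exists_homologyMap (f : A →+* B) (h2 : (2 : B) = 0) (hf : Function.Surjective f)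
    (hf' : ∀ a, f a = 0 → a ∈ Ideal.span ({2} : Set A))
    (d₂ : ((A ⊗[ℤ] (A ⊗[ℤ] (A ⊗[ℤ] A))) × A) →ₗ[ℤ] A ⊗[ℤ] (A ⊗[ℤ] A))
    (hd : ∀ a b c d : A, d₂ (a ⊗ₜ[ℤ] (b ⊗ₜ[ℤ] (c ⊗ₜ[ℤ] d)), 0) =
      (a * b) ⊗ₜ[ℤ] (c ⊗ₜ[ℤ] d) + d ⊗ₜ[ℤ] ((c * a) ⊗ₜ[ℤ] b) +
        (b * c * a) ⊗ₜ[ℤ] ((1 : A) ⊗ₜ[ℤ] d) + d ⊗ₜ[ℤ] ((b * c) ⊗ₜ[ℤ] a))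
    (hd' : ∀ a : A, d₂ (0, a) = (1 : A) ⊗ₜ[ℤ] (a ⊗ₜ[ℤ] (1 : A))) :
    ∃ H : A ⊗[ℤ] (A ⊗[ℤ] A) →ₗ[ℤ] B,
      Function.Surjective H ∧ LinearMap.ker H = LinearMap.range d₂ ∧
      ∀ a x y z : A, H ((a * x) ⊗ₜ[ℤ] (y ⊗ₜ[ℤ] z) - x ⊗ₜ[ℤ] ((y * a) ⊗ₜ[ℤ] z) +
        x ⊗ₜ[ℤ] (y ⊗ₜ[ℤ] (a * z))) = f a * H (x ⊗ₜ[ℤ] (y ⊗ₜ[ℤ] z)) :=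
  ⟨homologyMap f h2, homologyMap_surjective f h2 hf,
    ker_homologyMap_eq_range f h2 hf' d₂ hd hd', homologyMap_smul f h2⟩

end Derivative

/-- A surjection with kernel `im d₂` identifies the homology with its target when `d₁ = 0`. -/
theorem exists_homology_addEquiv {L M N P : Type*} [AddCommGroup L] [AddCommGroup M]
    [AddCommGroup N] [AddCommGroup P] (d₁ : M →ₗ[ℤ] N) (d₂ : L →ₗ[ℤ] M) (hd : d₁ = 0)
    (H : M →ₗ[ℤ] P) (hH : Function.Surjective H) (hker : LinearMap.ker H = LinearMap.range d₂) :
    ∃ e : (↥(LinearMap.ker d₁) ⧸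
        Submodule.comap (LinearMap.ker d₁).subtype (LinearMap.range d₂)) ≃+ P,
      ∀ m : LinearMap.ker d₁, e (Submodule.Quotient.mk m) = H m := by
  subst hd
  have hsurj : Function.Surjective (H ∘ₗ (LinearMap.ker (0 : M →ₗ[ℤ] N)).subtype) := fun p => by
    obtain ⟨m, rfl⟩ := hH p
    exact ⟨⟨m, rfl⟩, rfl⟩
  have hcomap : Submodule.comap (LinearMap.ker (0 : M →ₗ[ℤ] N)).subtype (LinearMap.range d₂) =
      LinearMap.ker (H ∘ₗ (LinearMap.ker (0 : M →ₗ[ℤ] N)).subtype) := by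
    rw [LinearMap.ker_comp, hker]
  exact ⟨((Submodule.quotEquivOfEq _ _ hcomap).trans
    (LinearMap.quotKerEquivOfSurjective _ hsurj)).toAddEquiv, fun m => rfl⟩

/-- A quotient of `A` is cyclic, also after transport of its module structure. -/
theorem span_symm_mk_one {R Q : Type*} [CommRing R] [AddCommGroup Q] (I : Ideal R)
    (e : Q ≃+ R ⧸ I) :
    letI := e.module R
    Submodule.span R {e.symm (Ideal.Quotient.mk I 1)} = ⊤ := by
  let := e.module R
  refine (Submodule.eq_top_iff').2 fun x => Submodule.mem_span_singleton.2 ?_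
  obtain ⟨a, ha⟩ := Ideal.Quotient.mk_surjective (e x)
  refine ⟨a, (e.linearEquiv R).injective ?_⟩
  rw [map_smul]
  change a • e (e.symm (Ideal.Quotient.mk I 1)) = e x
  rw [e.apply_symm_apply, ← ha, map_one, Algebra.smul_def, mul_one, Ideal.Quotient.algebraMap_eq]

/-- For `A = ℤ[t]/(t⁴)`, the first homology `H₁ = ker ∂₁ / im ∂₂` of the partial
complex, equipped with its `A`-module structure
`[a]·[x⊗y⊗z] = [ax⊗y⊗z − x⊗ya⊗z + x⊗y⊗az]`, is a cyclic `A`-module: it is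
generated by a single element `u` satisfying `2u = 0`, and is isomorphic as an
`A`-module to `A/2A`. -/
theorem HS1_int_t_fourth_module_structure
    (d₁ : A ⊗[ℤ] (A ⊗[ℤ] A) →ₗ[ℤ] A)
    (d₂ : ((A ⊗[ℤ] (A ⊗[ℤ] (A ⊗[ℤ] A))) × A) →ₗ[ℤ] A ⊗[ℤ] (A ⊗[ℤ] A))
    (h₁ : ∀ a b c : A, d₁ (a ⊗ₜ[ℤ] (b ⊗ₜ[ℤ] c)) = a * b * c - c * b * a)
    (h₂ : ∀ a b c d : A, d₂ (a ⊗ₜ[ℤ] (b ⊗ₜ[ℤ] (c ⊗ₜ[ℤ] d)), 0) =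
      (a * b) ⊗ₜ[ℤ] (c ⊗ₜ[ℤ] d) + d ⊗ₜ[ℤ] ((c * a) ⊗ₜ[ℤ] b) +
        (b * c * a) ⊗ₜ[ℤ] ((1 : A) ⊗ₜ[ℤ] d) + d ⊗ₜ[ℤ] ((b * c) ⊗ₜ[ℤ] a))
    (h₃ : ∀ a : A, d₂ (0, a) = (1 : A) ⊗ₜ[ℤ] (a ⊗ₜ[ℤ] (1 : A))) :
    ∃ sm : Module A (↥(LinearMap.ker d₁) ⧸
        Submodule.comap (LinearMap.ker d₁).subtype (LinearMap.range d₂)),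
      letI := sm
      -- the action is the one induced by `[a]·[x⊗y⊗z] = [ax⊗y⊗z − x⊗ya⊗z + x⊗y⊗az]`
      (∀ (a x y z : A) (h : x ⊗ₜ[ℤ] (y ⊗ₜ[ℤ] z) ∈ LinearMap.ker d₁)
        (h' : (a * x) ⊗ₜ[ℤ] (y ⊗ₜ[ℤ] z) - x ⊗ₜ[ℤ] ((y * a) ⊗ₜ[ℤ] z) +
            x ⊗ₜ[ℤ] (y ⊗ₜ[ℤ] (a * z)) ∈ LinearMap.ker d₁),
        a • (Submodule.Quotient.mk ⟨_, h⟩ :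
            ↥(LinearMap.ker d₁) ⧸
              Submodule.comap (LinearMap.ker d₁).subtype (LinearMap.range d₂)) =
          Submodule.Quotient.mk ⟨_, h'⟩)
      -- it is cyclic, generated by `u` with `2u = 0`
      ∧ (∃ u : ↥(LinearMap.ker d₁) ⧸
            Submodule.comap (LinearMap.ker d₁).subtype (LinearMap.range d₂),
          (2 : A) • u = 0 ∧ Submodule.span A {u} = ⊤)
      -- and it is isomorphic as an `A`-module to `A/2A`
      ∧ Nonempty ((↥(LinearMap.ker d₁) ⧸
            Submodule.comap (LinearMap.ker d₁).subtype (LinearMap.range d₂)) ≃ₗ[A]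
          A ⧸ Ideal.span ({2} : Set A)) := by
  have h2 : (2 : A ⧸ Ideal.span ({2} : Set A)) = 0 :=
    Ideal.Quotient.eq_zero_iff_mem.2 (Ideal.mem_span_singleton_self (2 : A))
  obtain ⟨H, hsurj, hker, hsmul⟩ := exists_homologyMap (B := A ⧸ Ideal.span ({2} : Set A))
    (Ideal.Quotient.mk _) h2 Ideal.Quotient.mk_surjective
    (fun a => Ideal.Quotient.eq_zero_iff_mem.1) d₂ h₂ h₃
  have hd : d₁ = 0 := A.tensor_linearMap_ext fun n m k => by
    rw [h₁, LinearMap.zero_apply]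
    ring
  obtain ⟨e, he⟩ := exists_homology_addEquiv d₁ d₂ hd H hsurj hker
  refine ⟨e.module A, fun a x y z h h' => e.injective ?_,
    ⟨e.symm (Ideal.Quotient.mk _ 1), e.injective ?_, span_symm_mk_one _ e⟩, ⟨e.linearEquiv A⟩⟩
  · refine (e.apply_symm_apply _).trans ?_
    change a • e (Submodule.Quotient.mk ⟨_, h⟩) = e (Submodule.Quotient.mk ⟨_, h'⟩)
    rw [he, he]
    exact (Algebra.smul_def a _).trans (hsmul a x y z).symm
  · refine (e.apply_symm_apply _).trans ?_
    rw [map_zero]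
    change (2 : A) • e (e.symm (Ideal.Quotient.mk _ 1)) = 0
    rw [e.apply_symm_apply]
    exact Ideal.Quotient.eq_zero_iff_mem.2
      (Ideal.mem_span_singleton'.2 ⟨1, mul_comm 1 2⟩)
end
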